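/- arXiv:0809.2833 — 8 statements merged into one kernel-verified Lean document; each statement's English description precedes it below -/
import Mathlib

section
/- Let α = α_s ∈ Δ be a simple root and β ∈ Φ⁺ a positive root of type A_n with α ≠ β. If there exist a simple root β₁ ∈ Δ and σ ∈ ℤ^n with α + β = β₁ + 2σ, then necessarily either s ≥ 2, β = α_{s−1} + α_s, β₁ = α_{s−1} and σ = α_s, or s ≤ n−1, β = α_s + α_{s+1}, β₁ = α_{s+1} and σ = α_s; conversely each of these is a solution. In other words, the only solutions have β = α + γ for a simple root γ adjacent to α, with β₁ = γ and σ = α. (This is the combinatorial classification established in the proof of Proposition 3.2 of the paper.) -/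
/-- The `i`-th simple root of type `Aₙ` (`1 ≤ i ≤ n`), as a vector in `ℤⁿ`:
the simple roots are the standard basis vectors (indices are 1-based). -/
def simpleRoot (n i : ℕ) : Fin n → ℤ := fun k => if (k : ℕ) + 1 = i then 1 else 0

/-- The positive root `αᵢ + αᵢ₊₁ + ⋯ + αⱼ` of type `Aₙ` (the indicator vector of the
interval `[i, j]`, 1-based indices). -/
def intervalRoot (n i j : ℕ) : Fin n → ℤ :=
  fun k => if i ≤ (k : ℕ) + 1 ∧ (k : ℕ) + 1 ≤ j then 1 else 0

/-- `v` is a simple root of type `Aₙ`. -/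
def IsSimpleRoot (n : ℕ) (v : Fin n → ℤ) : Prop :=
  ∃ i, 1 ≤ i ∧ i ≤ n ∧ v = simpleRoot n i

/-- `v` is a positive root of type `Aₙ`. -/
def IsPositiveRootA (n : ℕ) (v : Fin n → ℤ) : Prop :=
  ∃ i j, 1 ≤ i ∧ i ≤ j ∧ j ≤ n ∧ v = intervalRoot n i j

/-- In type `Aₙ`, for the simple root `α = αₛ` and a positive root `β ≠ α`, the solutions
of `α + β = β₁ + 2σ` with `β₁` simple and `σ ∈ ℤⁿ` are exactly:
`β = α_{s-1} + αₛ`, `β₁ = α_{s-1}`, `σ = αₛ` (when `s ≥ 2`), and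
`β = αₛ + α_{s+1}`, `β₁ = α_{s+1}`, `σ = αₛ` (when `s ≤ n - 1`). -/
theorem An_classify_beta1_two_sigma (n : ℕ) (hn : 1 ≤ n) (s : ℕ)
    (hs1 : 1 ≤ s) (hsn : s ≤ n) (β : Fin n → ℤ) (hβ : IsPositiveRootA n β)
    (hne : simpleRoot n s ≠ β) (β₁ σ : Fin n → ℤ) (hβ₁ : IsSimpleRoot n β₁) :
    simpleRoot n s + β = β₁ + 2 • σ ↔
      (2 ≤ s ∧ β = intervalRoot n (s - 1) s ∧ β₁ = simpleRoot n (s - 1) ∧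
        σ = simpleRoot n s) ∨
      (s + 1 ≤ n ∧ β = intervalRoot n s (s + 1) ∧ β₁ = simpleRoot n (s + 1) ∧
        σ = simpleRoot n s) := by
  obtain ⟨i, j, hi, hij, hj, rfl⟩ := hβ
  obtain ⟨t, ht1, htn, rfl⟩ := hβ₁
  constructor
  · intro h
    have key : ∀ k, 1 ≤ k → k ≤ n → ∃ z : ℤ,
        (if k = s then (1 : ℤ) else 0) + (if i ≤ k ∧ k ≤ j then 1 else 0)
          = (if k = t then 1 else 0) + 2 * z := by
      intro k hk1 hkn
      have hk := congrFun h ⟨k - 1, by omega⟩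
      simp only [Pi.add_apply, Pi.mul_apply, Pi.ofNat_apply, simpleRoot, intervalRoot,
        Nat.sub_add_cancel hk1, nsmul_eq_mul, Nat.cast_ofNat] at hk
      exact ⟨_, hk⟩
    have hnij : ¬ (i = s ∧ j = s) := by
      rintro ⟨rfl, rfl⟩
      apply hne
      funext k
      simp only [simpleRoot, intervalRoot]
      split_ifs <;> omega
    obtain ⟨zs, hzs⟩ := key s hs1 hsn
    obtain ⟨zi, hzi⟩ := key i hi (by omega)
    obtain ⟨zj, hzj⟩ := key j (by omega) hj
    have hmem : i ≤ s ∧ s ≤ j := by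
      split_ifs at hzs hzi <;> omega
    have hts : t ≠ s := by
      rintro rfl
      split_ifs at hzs <;> omega
    have hti : i ≠ s → t = i := by
      intro hh
      split_ifs at hzi <;> omega
    have htj : j ≠ s → t = j := by
      intro hh
      split_ifs at hzj <;> omega
    have hcases : (i + 1 = s ∧ j = s ∧ t = i) ∨ (i = s ∧ j = s + 1 ∧ t = j) := by
      by_cases his : i = s
      · obtain ⟨z, hz⟩ := key (s + 1) (by omega) (by omega)
        right
        split_ifs at hz <;> omega
      · obtain ⟨z, hz⟩ := key (s - 1) (by omega) (by omega)
        left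
        split_ifs at hz <;> omega
    have hσ : σ = simpleRoot n s := by
      funext k
      have hk := congrFun h k
      simp only [Pi.add_apply, Pi.mul_apply, Pi.ofNat_apply, simpleRoot, intervalRoot,
        nsmul_eq_mul, Nat.cast_ofNat] at hk ⊢
      split_ifs at hk ⊢ <;> omega
    rcases hcases with ⟨h1, h2, h3⟩ | ⟨h1, h2, h3⟩
    · left
      have h4 : s - 1 = i := by omega
      rw [h4, h2, h3]
      exact ⟨by omega, rfl, rfl, hσ⟩
    · right
      subst h1
      subst h2
      rw [h3]
      exact ⟨hj, rfl, rfl, hσ⟩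
  · rintro (⟨h1, h2, h3, h4⟩ | ⟨h1, h2, h3, h4⟩) <;>
    · rw [h2, h3, h4]
      funext k
      simp only [Pi.add_apply, Pi.mul_apply, Pi.ofNat_apply, simpleRoot, intervalRoot,
        nsmul_eq_mul, Nat.cast_ofNat]
      split_ifs <;> omega
end

section
/- Let α = α_s ∈ Δ be a simple root and β ∈ Φ⁺ a positive root of type A_n with α ≠ β, and suppose β₁, β₂ ∈ Δ and σ ∈ ℤ^n satisfy α + β = β₁ + β₂ + 2σ. Then β₁ ≠ β₂, and exactly one of the following holds: (i) σ = 0, β = α_t is a simple root with t ≠ s, and {β₁, β₂} = {α_s, α_t}; or (ii) σ = α_s and (β, {β₁, β₂}) is one of: (α_{s−2} + α_{s−1} + α_s, {α_{s−2}, α_{s−1}}) with s ≥ 3, (α_{s−1} + α_s + α_{s+1}, {α_{s−1}, α_{s+1}}) with 2 ≤ s ≤ n−1, or (α_s + α_{s+1} + α_{s+2}, {α_{s+1}, α_{s+2}}) with s ≤ n−2. Conversely, each listed case is a solution. (This is the combinatorial content of Proposition 3.3 of the paper, classifying solutions of α + β = β₁ + β₂ + 2σ in type A_n.) -/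
/-- `{β₁, β₂}` equals the (unordered) pair of simple roots `{α_a, α_b}`. -/
def PairEq (n : ℕ) (β₁ β₂ : Fin n → ℤ) (a b : ℕ) : Prop :=
  (β₁ = simpleRoot n a ∧ β₂ = simpleRoot n b) ∨
  (β₁ = simpleRoot n b ∧ β₂ = simpleRoot n a)

set_option maxHeartbeats 1000000 in
theorem combi_aux (n s i j a b : ℕ) (hs1 : 1 ≤ s) (hsn : s ≤ n) (hi : 1 ≤ i) (hij : i ≤ j)
    (hj : j ≤ n) (ha1 : 1 ≤ a) (han : a ≤ n) (hb1 : 1 ≤ b) (hbn : b ≤ n)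
    (hne : ¬ (i = s ∧ j = s))
    (P : ∀ m, 1 ≤ m → m ≤ n → (((m = s) ↔ (i ≤ m ∧ m ≤ j)) ↔ ((m = a) ↔ (m = b)))) :
    a ≠ b ∧ ((i = j ∧ i ≠ s ∧ ((a = s ∧ b = i) ∨ (a = i ∧ b = s))) ∨
      (j = i + 2 ∧ ((s = i + 2 ∧ ((a = i ∧ b = i + 1) ∨ (a = i + 1 ∧ b = i))) ∨
        (s = i + 1 ∧ ((a = i ∧ b = i + 2) ∨ (a = i + 2 ∧ b = i))) ∨
        (s = i ∧ ((a = i + 1 ∧ b = i + 2) ∨ (a = i + 2 ∧ b = i + 1)))))) := by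
  have R : ∀ m, i ≤ m → m ≤ j → m ≠ s → (m = a ∨ m = b) ∧ ¬ (m = a ∧ m = b) := by
    intro m h1 h2 h3
    have := P m (by omega) (by omega)
    tauto
  have hab : a ≠ b := by
    rintro rfl
    have h1 := R i le_rfl hij
    have h2 := R j hij le_rfl
    omega
  have T : ∀ m, 1 ≤ m → m ≤ n → (m = a ∨ m = b) → (m = s ∧ ¬ (i ≤ m ∧ m ≤ j)) ∨
      (m ≠ s ∧ (i ≤ m ∧ m ≤ j)) := by
    intro m h1 h2 h3
    have := P m h1 h2
    have h4 : ¬ (m = a ∧ m = b) := by omega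
    tauto
  have Ta := T a ha1 han (Or.inl rfl)
  have Tb := T b hb1 hbn (Or.inr rfl)
  refine ⟨hab, ?_⟩
  have Ri := R i le_rfl hij
  have Rj := R j hij le_rfl
  by_cases hs : i ≤ s ∧ s ≤ j
  · have ha : a ≠ s ∧ i ≤ a ∧ a ≤ j := by omega
    have hb : b ≠ s ∧ i ≤ b ∧ b ≤ j := by omega
    have hlen : j ≤ i + 2 := by
      by_contra hc
      have Q : ∀ m, i ≤ m → m ≤ j → m ≠ s → m = a ∨ m = b := fun m h1 h2 h3 => (R m h1 h2 h3).1
      have Q0 := Q i (by omega) (by omega)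
      have Q1 := Q (i + 1) (by omega) (by omega)
      have Q2 := Q (i + 2) (by omega) (by omega)
      have Q3 := Q (i + 3) (by omega) (by omega)
      clear R T P Ta Tb Ri Rj Q
      by_cases c0 : i = s
      · have q1 := Q1 (by omega)
        have q2 := Q2 (by omega)
        have q3 := Q3 (by omega)
        omega
      have q0 := Q0 c0
      by_cases c1 : i + 1 = s
      · have q2 := Q2 (by omega)
        have q3 := Q3 (by omega)
        omega
      have q1 := Q1 c1
      by_cases c2 : i + 2 = s
      · have q3 := Q3 (by omega)
        omega
      have q2 := Q2 c2
      omega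
    clear R T P Ta Tb Ri Rj
    obtain rfl | rfl | rfl : j = i ∨ j = i + 1 ∨ j = i + 2 := by omega
    · omega
    · omega
    · have h1 : s = i ∨ s = i + 1 ∨ s = i + 2 := by omega
      have h2 : a = i ∨ a = i + 1 ∨ a = i + 2 := by omega
      have h3 : b = i ∨ b = i + 1 ∨ b = i + 2 := by omega
      right
      clear hs hlen
      rcases h1 with rfl | rfl | rfl <;> rcases h2 with rfl | rfl | rfl <;>
        rcases h3 with rfl | rfl | rfl <;> simp at ha hb hab ⊢
  · have Ps' : s = a ∨ s = b := by
      have := P s hs1 hsn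
      by_contra hc
      rw [not_or] at hc
      exact hs ((this.2 (iff_of_false hc.1 hc.2)).1 rfl)
    have e1 := (Ri (by omega)).1
    have e2 := (Rj (by omega)).1
    left
    clear R T P Ta Tb Ri Rj
    rcases Ps' with rfl | rfl <;> omega

/-- In type `Aₙ`, for the simple root `α = αₛ`, a positive root `β ≠ α`, simple roots
`β₁, β₂` and `σ ∈ ℤⁿ`, the equation `α + β = β₁ + β₂ + 2σ` holds iff `β₁ ≠ β₂` and
either (i) `σ = 0`, `β = α_t` is simple with `t ≠ s` and `{β₁, β₂} = {αₛ, α_t}`, or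
(ii) `σ = αₛ` and `(β, {β₁, β₂})` is one of
`(α_{s-2} + α_{s-1} + αₛ, {α_{s-2}, α_{s-1}})` (when `s ≥ 3`),
`(α_{s-1} + αₛ + α_{s+1}, {α_{s-1}, α_{s+1}})` (when `2 ≤ s ≤ n-1`), or
`(αₛ + α_{s+1} + α_{s+2}, {α_{s+1}, α_{s+2}})` (when `s ≤ n-2`). -/
theorem An_classify_two_simples_two_sigma (n : ℕ) (hn : 1 ≤ n) (s : ℕ)
    (hs1 : 1 ≤ s) (hsn : s ≤ n) (β : Fin n → ℤ) (hβ : IsPositiveRootA n β)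
    (hne : simpleRoot n s ≠ β) (β₁ β₂ σ : Fin n → ℤ)
    (hβ₁ : IsSimpleRoot n β₁) (hβ₂ : IsSimpleRoot n β₂) :
    simpleRoot n s + β = β₁ + β₂ + 2 • σ ↔
      (β₁ ≠ β₂ ∧
        ((σ = 0 ∧ ∃ t, 1 ≤ t ∧ t ≤ n ∧ t ≠ s ∧ β = simpleRoot n t ∧
            PairEq n β₁ β₂ s t) ∨
         (σ = simpleRoot n s ∧
           ((3 ≤ s ∧ β = intervalRoot n (s - 2) s ∧ PairEq n β₁ β₂ (s - 2) (s - 1)) ∨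
            (2 ≤ s ∧ s + 1 ≤ n ∧ β = intervalRoot n (s - 1) (s + 1) ∧
              PairEq n β₁ β₂ (s - 1) (s + 1)) ∨
            (s + 2 ≤ n ∧ β = intervalRoot n s (s + 2) ∧
              PairEq n β₁ β₂ (s + 1) (s + 2)))))) := by
  obtain ⟨i, j, hi, hij, hj, rfl⟩ := hβ
  obtain ⟨a, ha1, han, rfl⟩ := hβ₁
  obtain ⟨b, hb1, hbn, rfl⟩ := hβ₂
  constructor
  · intro h
    have hk : ∀ k : Fin n, (if (k : ℕ) + 1 = s then (1 : ℤ) else 0) +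
        (if i ≤ (k : ℕ) + 1 ∧ (k : ℕ) + 1 ≤ j then 1 else 0) =
        (if (k : ℕ) + 1 = a then 1 else 0) + (if (k : ℕ) + 1 = b then 1 else 0) + 2 * σ k := by
      intro k
      have := congrFun h k
      simpa [simpleRoot, intervalRoot] using this
    have key := combi_aux n s i j a b hs1 hsn hi hij hj ha1 han hb1 hbn
      (by
        rintro ⟨rfl, rfl⟩
        apply hne
        funext k
        simp only [simpleRoot, intervalRoot]
        congr 1
        apply propext
        omega)
      (by
        intro m hm1 hmn
        have := hk ⟨m - 1, by omega⟩
        simp only [Nat.sub_add_cancel hm1] at this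
        split_ifs at this <;> first | omega | simp_all)
    obtain ⟨hab, key⟩ := key
    have hab' : simpleRoot n a ≠ simpleRoot n b := by
      intro he
      have := congrFun he ⟨a - 1, by omega⟩
      simp [simpleRoot, Nat.sub_add_cancel ha1, hab] at this
    refine ⟨hab', ?_⟩
    rcases key with ⟨rfl, his, hc⟩ | ⟨rfl, hc⟩
    · left
      refine ⟨?_, i, hi, hj, his, ?_, ?_⟩
      · funext k
        have := hk k
        simp only [Pi.zero_apply]
        rcases hc with ⟨rfl, rfl⟩ | ⟨rfl, rfl⟩ <;> split_ifs at this <;> omega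
      · funext k
        simp only [simpleRoot, intervalRoot]
        congr 1
        apply propext
        omega
      · rcases hc with ⟨rfl, rfl⟩ | ⟨rfl, rfl⟩
        · exact Or.inl ⟨rfl, rfl⟩
        · exact Or.inr ⟨rfl, rfl⟩
    · right
      constructor
      · funext k
        have := hk k
        simp only [simpleRoot]
        rcases hc with ⟨rfl, ⟨rfl, rfl⟩ | ⟨rfl, rfl⟩⟩ | ⟨rfl, ⟨rfl, rfl⟩ | ⟨rfl, rfl⟩⟩ |
          ⟨rfl, ⟨rfl, rfl⟩ | ⟨rfl, rfl⟩⟩ <;> split_ifs at this ⊢ <;> omega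
      · rcases hc with ⟨rfl, hc⟩ | ⟨rfl, hc⟩ | ⟨rfl, hc⟩
        · left
          refine ⟨by omega, rfl, ?_⟩
          rcases hc with ⟨rfl, rfl⟩ | ⟨rfl, rfl⟩
          · exact Or.inl ⟨rfl, rfl⟩
          · exact Or.inr ⟨rfl, rfl⟩
        · right; left
          refine ⟨by omega, by omega, rfl, ?_⟩
          rcases hc with ⟨rfl, rfl⟩ | ⟨rfl, rfl⟩
          · exact Or.inl ⟨rfl, rfl⟩
          · exact Or.inr ⟨rfl, rfl⟩
        · right; right
          refine ⟨by omega, rfl, ?_⟩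
          rcases hc with ⟨rfl, rfl⟩ | ⟨rfl, rfl⟩
          · exact Or.inl ⟨rfl, rfl⟩
          · exact Or.inr ⟨rfl, rfl⟩
  · rintro ⟨-, ⟨rfl, t, ht1, htn, hts, hb, hp⟩ | ⟨rfl, ⟨h3, hb, hp⟩ | ⟨h2, h3, hb, hp⟩ | ⟨h3, hb, hp⟩⟩⟩ <;>
      rw [hb] <;> rcases hp with ⟨e1, e2⟩ | ⟨e1, e2⟩ <;> rw [e1, e2] <;> funext k <;>
      simp only [simpleRoot, intervalRoot, two_smul, Pi.add_apply, Pi.zero_apply] <;> split_ifs <;> omega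
end

section
/- Let α ∈ Δ be a simple root and β ∈ Φ⁺ a positive root of type B_n. Then all coordinates of α + β are even (i.e. α + β = 2σ for some σ ∈ ℤ^n) if and only if either α = β, or there exists 1 ≤ i ≤ n−1 with α = α_i and β = α_i + 2α_{i+1} + ⋯ + 2α_n, in which case α + β = 2(α_i + α_{i+1} + ⋯ + α_n), twice a (short) positive root. (This is the classification, established in Section 3.3 of the paper, of solutions of α + β = 2σ in type B_n, underlying the extra weights 2(α_i + ⋯ + α_n) in the computation of H²(U₁,k).) -/
/-- The positive root `αᵢ + ⋯ + α_{j-1} + 2αⱼ + ⋯ + 2αₙ` of type `Bₙ` (`1 ≤ i < j ≤ n`). -/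
def doubledRootB (n i j : ℕ) : Fin n → ℤ := fun k =>
  if (k : ℕ) + 1 < i then 0 else if (k : ℕ) + 1 < j then 1 else 2

/-- `v` is a positive root of type `Bₙ`. -/
def IsPositiveRootB (n : ℕ) (v : Fin n → ℤ) : Prop :=
  (∃ i j, 1 ≤ i ∧ i ≤ j ∧ j ≤ n ∧ v = intervalRoot n i j) ∨
  (∃ i j, 1 ≤ i ∧ i < j ∧ j ≤ n ∧ v = doubledRootB n i j)

/-- In type `Bₙ`, for a simple root `α` and a positive root `β`, all coordinates of
`α + β` are even (i.e. `α + β = 2σ` for some `σ ∈ ℤⁿ`) iff `α = β`, or `α = αᵢ` and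
`β = αᵢ + 2α_{i+1} + ⋯ + 2αₙ` for some `1 ≤ i ≤ n - 1`, in which case
`α + β = 2(αᵢ + α_{i+1} + ⋯ + αₙ)`. -/
theorem Bn_sum_twice_lattice_classification (n : ℕ) (hn : 3 ≤ n) (α β : Fin n → ℤ)
    (hα : IsSimpleRoot n α) (hβ : IsPositiveRootB n β) :
    (∃ σ : Fin n → ℤ, α + β = 2 • σ) ↔
      (α = β ∨
        ∃ i, 1 ≤ i ∧ i + 1 ≤ n ∧ α = simpleRoot n i ∧ β = doubledRootB n i (i + 1) ∧
          α + β = 2 • intervalRoot n i n) := by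
  obtain ⟨a, ha1, han, rfl⟩ := hα
  constructor
  · rintro ⟨σ, h⟩
    rcases hβ with ⟨b, c, hb, hbc, hc, rfl⟩ | ⟨b, c, hb, hbc, hc, rfl⟩
    · left
      have h1 := congrFun h ⟨b - 1, by omega⟩
      have h2 := congrFun h ⟨c - 1, by omega⟩
      simp only [simpleRoot, intervalRoot, Pi.add_apply, Pi.smul_apply, nsmul_eq_mul,
        Nat.cast_ofNat] at h1 h2
      have e1 : a = b := by split_ifs at h1 <;> omega
      have e2 : a = c := by split_ifs at h2 <;> omega
      subst e1
      subst e2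
      funext k
      simp only [simpleRoot, intervalRoot]
      split_ifs <;> omega
    · right
      have h1 := congrFun h ⟨b - 1, by omega⟩
      have h2 := congrFun h ⟨c - 2, by omega⟩
      simp only [simpleRoot, doubledRootB, Pi.add_apply, Pi.smul_apply, nsmul_eq_mul,
        Nat.cast_ofNat] at h1 h2
      have e1 : a = b := by split_ifs at h1 <;> omega
      have e2 : c = a + 1 := by split_ifs at h2 <;> omega
      subst e1
      subst e2
      refine ⟨a, ha1, hc, rfl, rfl, ?_⟩
      funext k
      have hk := k.isLt
      simp only [simpleRoot, doubledRootB, intervalRoot, Pi.add_apply, Pi.smul_apply,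
        nsmul_eq_mul, Nat.cast_ofNat]
      split_ifs <;> omega
  · rintro (rfl | ⟨i, -, -, -, -, h⟩)
    · exact ⟨_, (two_nsmul _).symm⟩
    · exact ⟨_, h⟩
end

section
/- Let α ∈ Δ be a simple root and β ∈ Φ⁺ a positive root of type C_n. Then all coordinates of α + β are even (i.e. α + β = 2σ for some σ ∈ ℤ^n) if and only if either α = β, or α = α_n and β = 2α_i + ⋯ + 2α_{n−1} + α_n for some 1 ≤ i ≤ n−1, in which case α + β = 2(α_i + ⋯ + α_{n−1} + α_n). (This is the classification, established in Section 3.4 (Case 1) of the paper, of solutions of α + β = 2σ in type C_n.) -/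
/-- For `1 ≤ i < j ≤ n-1`, the positive root
`αᵢ + ⋯ + α_{j-1} + 2αⱼ + ⋯ + 2α_{n-1} + αₙ` of type `Cₙ`;
for `j = i` it is the positive root `2αᵢ + ⋯ + 2α_{n-1} + αₙ`. -/
def doubledRootC (n i j : ℕ) : Fin n → ℤ := fun k =>
  if (k : ℕ) + 1 = n then 1
  else if (k : ℕ) + 1 < i then 0
  else if (k : ℕ) + 1 < j then 1 else 2

/-- `v` is a positive root of type `Cₙ`. -/
def IsPositiveRootC (n : ℕ) (v : Fin n → ℤ) : Prop :=
  (∃ i j, 1 ≤ i ∧ i ≤ j ∧ j ≤ n ∧ v = intervalRoot n i j) ∨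
  (∃ i j, 1 ≤ i ∧ i < j ∧ j + 1 ≤ n ∧ v = doubledRootC n i j) ∨
  (∃ i, 1 ≤ i ∧ i + 1 ≤ n ∧ v = doubledRootC n i i)

/-- In type `Cₙ`, for a simple root `α` and a positive root `β`, all coordinates of
`α + β` are even (i.e. `α + β = 2σ` for some `σ ∈ ℤⁿ`) iff `α = β`, or `α = αₙ` and
`β = 2αᵢ + ⋯ + 2α_{n-1} + αₙ` for some `1 ≤ i ≤ n - 1`, in which case
`α + β = 2(αᵢ + ⋯ + α_{n-1} + αₙ)`. -/
theorem Cn_sum_twice_lattice_classification (n : ℕ) (hn : 3 ≤ n) (α β : Fin n → ℤ)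
    (hα : IsSimpleRoot n α) (hβ : IsPositiveRootC n β) :
    (∃ σ : Fin n → ℤ, α + β = 2 • σ) ↔
      (α = β ∨
        (α = simpleRoot n n ∧ ∃ i, 1 ≤ i ∧ i + 1 ≤ n ∧ β = doubledRootC n i i ∧
          α + β = 2 • intervalRoot n i n)) := by
  obtain ⟨a, ha1, han, rfl⟩ := hα
  constructor
  · rintro ⟨σ, hσ⟩
    have key : ∀ k, ∀ hk : 1 ≤ k ∧ k ≤ n,
        (if k = a then (1 : ℤ) else 0) + β ⟨k - 1, by omega⟩ = 2 * σ ⟨k - 1, by omega⟩ := by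
      intro k hk
      have h := congrFun hσ ⟨k - 1, by omega⟩
      have e : k - 1 + 1 = k := by omega
      simpa [simpleRoot, e] using h
    rcases hβ with ⟨i, j, hi, hij, hj, rfl⟩ | ⟨i, j, hi, hij, hj, rfl⟩ | ⟨i, hi, hin, rfl⟩
    · left
      have h1 := key i (by omega)
      have h2 := key j (by omega)
      simp only [intervalRoot] at h1 h2
      have hia : i = a := by split_ifs at h1 <;> omega
      have hja : j = a := by split_ifs at h2 <;> omega
      subst hia
      subst hja
      funext k
      simp only [simpleRoot, intervalRoot]
      split_ifs <;> omega
    · exfalso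
      have h1 := key i (by omega)
      have h2 := key n (by omega)
      simp only [doubledRootC] at h1 h2
      have hia : i = a := by split_ifs at h1 <;> omega
      have hja : n = a := by split_ifs at h2 <;> omega
      omega
    · right
      have h2 := key n (by omega)
      simp only [doubledRootC] at h2
      have hja : n = a := by split_ifs at h2 <;> omega
      subst hja
      refine ⟨rfl, i, hi, hin, rfl, ?_⟩
      funext k
      have := k.2
      simp only [simpleRoot, intervalRoot, doubledRootC, Pi.add_apply, Pi.smul_apply]
      split_ifs <;> first | omega | norm_num
  · rintro (h | ⟨_, i, _, _, _, h⟩)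
    · exact ⟨simpleRoot n a, by rw [← h, two_smul]⟩
    · exact ⟨_, h⟩
end

section
/- Let α ∈ Δ be a simple root and β ∈ Φ⁺ a positive root of type D_n. Then all coordinates of α + β are even (i.e. α + β = 2σ for some σ ∈ ℤ^n) if and only if α = β. (This is the type-D_n analogue, established in Section 3.5 of the paper, of the classification of solutions of α + β = 2σ: in type D_n there are no solutions with α ≠ β.) -/
/-- The positive root `αᵢ + ⋯ + α_{n-2} + αₙ` of type `Dₙ` (`1 ≤ i ≤ n-2`). -/
def rootDn (n i : ℕ) : Fin n → ℤ := fun k =>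
  if (k : ℕ) + 1 = n then 1
  else if i ≤ (k : ℕ) + 1 ∧ (k : ℕ) + 1 ≤ n - 2 then 1 else 0

/-- The positive root `αᵢ + ⋯ + α_{j-1} + 2αⱼ + ⋯ + 2α_{n-2} + α_{n-1} + αₙ`
of type `Dₙ` (`1 ≤ i < j ≤ n-1`). -/
def doubledRootD (n i j : ℕ) : Fin n → ℤ := fun k =>
  if n - 1 ≤ (k : ℕ) + 1 then 1
  else if (k : ℕ) + 1 < i then 0
  else if (k : ℕ) + 1 < j then 1 else 2

/-- `v` is a positive root of type `Dₙ`. -/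
def IsPositiveRootD (n : ℕ) (v : Fin n → ℤ) : Prop :=
  (∃ i j, 1 ≤ i ∧ i ≤ j ∧ j + 1 ≤ n ∧ v = intervalRoot n i j) ∨
  v = simpleRoot n n ∨
  (∃ i, 1 ≤ i ∧ i + 2 ≤ n ∧ v = rootDn n i) ∨
  (∃ i j, 1 ≤ i ∧ i < j ∧ j + 1 ≤ n ∧ v = doubledRootD n i j)

/-- In type `Dₙ`, for a simple root `α` and a positive root `β`, all coordinates of
`α + β` are even (i.e. `α + β = 2σ` for some `σ ∈ ℤⁿ`) iff `α = β`. -/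
theorem Dn_sum_twice_lattice_classification (n : ℕ) (hn : 4 ≤ n) (α β : Fin n → ℤ)
    (hα : IsSimpleRoot n α) (hβ : IsPositiveRootD n β) :
    (∃ σ : Fin n → ℤ, α + β = 2 • σ) ↔ α = β := by
  constructor
  swap
  · rintro rfl
    exact ⟨α, (two_nsmul α).symm⟩
  rintro ⟨σ, hσ⟩
  obtain ⟨a, ha1, han, rfl⟩ := hα
  have key : ∀ m : ℕ, ∀ hm : m < n,
      (if m + 1 = a then (1 : ℤ) else 0) + β ⟨m, hm⟩ = 2 * σ ⟨m, hm⟩ := by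
    intro m hm
    have h := congrFun hσ ⟨m, hm⟩
    simpa [simpleRoot] using h
  -- every odd coordinate of `β` sits at position `a`
  have odd_pos : ∀ m : ℕ, ∀ hm : m < n, β ⟨m, hm⟩ = 1 → m + 1 = a := by
    intro m hm h1
    have h := key m hm
    rw [h1] at h
    split_ifs at h with h2
    · exact h2
    · omega
  rcases hβ with ⟨i, j, hi, hij, hj, rfl⟩ | rfl | ⟨i, hi, hin, rfl⟩ | ⟨i, j, hi, hij, hj, rfl⟩
  · have h1 := odd_pos (i - 1) (by omega) (if_pos (by dsimp only; omega))
    have h2 := odd_pos (j - 1) (by omega) (if_pos (by dsimp only; omega))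
    funext k
    simp only [simpleRoot, intervalRoot]
    congr 1
    apply propext
    omega
  · have h1 := odd_pos (n - 1) (by omega) (if_pos (by dsimp only; omega))
    have h2 : a = n := by omega
    rw [h2]
  · have h1 := odd_pos (n - 1) (by omega) (if_pos (by dsimp only; omega))
    have h2 := odd_pos (n - 3) (by omega)
      ((if_neg (by dsimp only; omega)).trans (if_pos (by dsimp only; omega)))
    omega
  · have h1 := odd_pos (n - 1) (by omega) (if_pos (by dsimp only; omega))
    have h2 := odd_pos (n - 2) (by omega) (if_pos (by dsimp only; omega))
    omega
end

section
/- Let α = α_s ∈ Δ be a simple root and β ∈ Φ⁺ a positive root of type B_n with α ≠ β. If there exist a simple root β₁ ∈ Δ and σ ∈ ℤ^n with α + β = β₁ + 2σ, then one of the following holds: (i) s ≥ 2, β = α_{s−1} + α_s, β₁ = α_{s−1}, σ = α_s; (ii) s ≤ n−1, β = α_s + α_{s+1}, β₁ = α_{s+1}, σ = α_s; (iii) 2 ≤ s ≤ n−1, β = α_{s−1} + α_s + 2α_{s+1} + ⋯ + 2α_n, β₁ = α_{s−1}, σ = α_s + α_{s+1} + ⋯ + α_n; (iv) s ≤ n−2,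 β = α_s + α_{s+1} + 2α_{s+2} + ⋯ + 2α_n, β₁ = α_{s+1}, σ = α_s + α_{s+2} + ⋯ + α_n. Conversely, each listed case is a solution. (This is the classification of solutions of equation α + β = β₁ + 2σ in type B_n used in Section 3.3 of the paper.) -/
/-- If the symmetric difference of `{s}` and `{t}` is a nonempty interval `[i, j]`, then `s` and `t`
are adjacent and are the endpoints of the interval. -/
theorem adjacent_of_interval (n s t i j : ℕ) (hs1 : 1 ≤ s) (hsn : s ≤ n) (ht1 : 1 ≤ t)
    (htn : t ≤ n) (hi : 1 ≤ i) (hij : i ≤ j) (hj : j ≤ n)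
    (H : ∀ m, 1 ≤ m → m ≤ n → ((i ≤ m ∧ m ≤ j) ↔ ((m = s ∧ m ≠ t) ∨ (m ≠ s ∧ m = t)))) :
    (i = s ∧ j = s + 1 ∧ t = s + 1) ∨ (i + 1 = s ∧ j = s ∧ t + 1 = s) := by
  have ha := H s hs1 hsn
  have hb := H t ht1 htn
  have hc := H i hi (by omega)
  have hd := H j (by omega) hj
  by_cases hlt : i + 1 ≤ j
  · have he := H (i + 1) (by omega) (by omega)
    omega
  · omega

set_option maxHeartbeats 2000000 in
/-- In type `Bₙ`, for the simple root `α = αₛ` and a positive root `β ≠ α`, the solutions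
of `α + β = β₁ + 2σ` with `β₁` simple and `σ ∈ ℤⁿ` are exactly the four listed cases:
(i) `β = α_{s-1} + αₛ`, `β₁ = α_{s-1}`, `σ = αₛ` (`s ≥ 2`);
(ii) `β = αₛ + α_{s+1}`, `β₁ = α_{s+1}`, `σ = αₛ` (`s ≤ n-1`);
(iii) `β = α_{s-1} + αₛ + 2α_{s+1} + ⋯ + 2αₙ`, `β₁ = α_{s-1}`,
`σ = αₛ + α_{s+1} + ⋯ + αₙ` (`2 ≤ s ≤ n-1`);
(iv) `β = αₛ + α_{s+1} + 2α_{s+2} + ⋯ + 2αₙ`, `β₁ = α_{s+1}`,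
`σ = αₛ + α_{s+2} + ⋯ + αₙ` (`s ≤ n-2`). -/
theorem Bn_classify_beta1_two_sigma (n : ℕ) (hn : 3 ≤ n) (s : ℕ)
    (hs1 : 1 ≤ s) (hsn : s ≤ n) (β : Fin n → ℤ) (hβ : IsPositiveRootB n β)
    (hne : simpleRoot n s ≠ β) (β₁ σ : Fin n → ℤ) (hβ₁ : IsSimpleRoot n β₁) :
    simpleRoot n s + β = β₁ + 2 • σ ↔
      (2 ≤ s ∧ β = intervalRoot n (s - 1) s ∧ β₁ = simpleRoot n (s - 1) ∧
        σ = simpleRoot n s) ∨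
      (s + 1 ≤ n ∧ β = intervalRoot n s (s + 1) ∧ β₁ = simpleRoot n (s + 1) ∧
        σ = simpleRoot n s) ∨
      (2 ≤ s ∧ s + 1 ≤ n ∧ β = doubledRootB n (s - 1) (s + 1) ∧
        β₁ = simpleRoot n (s - 1) ∧ σ = intervalRoot n s n) ∨
      (s + 2 ≤ n ∧ β = doubledRootB n s (s + 2) ∧ β₁ = simpleRoot n (s + 1) ∧
        σ = simpleRoot n s + intervalRoot n (s + 2) n) := by
  constructor
  · intro h
    obtain ⟨t, ht1, htn, rfl⟩ := hβ₁
    have key : ∀ m, 1 ≤ m → ∀ hm : m - 1 < n,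
        (if m = s then (1 : ℤ) else 0) + β ⟨m - 1, hm⟩ =
          (if m = t then (1 : ℤ) else 0) + 2 * σ ⟨m - 1, hm⟩ := by
      intro m h1 hm
      have := congrFun h ⟨m - 1, hm⟩
      simpa [simpleRoot, Nat.sub_add_cancel h1] using this
    rcases hβ with ⟨i, j, hi, hij, hj, rfl⟩ | ⟨i, j, hi, hij, hj, rfl⟩
    · have key2 : ∀ m, 1 ≤ m → m ≤ n → ∃ c : ℤ, (if m = s then (1 : ℤ) else 0) +
          (if i ≤ m ∧ m ≤ j then 1 else 0) = (if m = t then (1 : ℤ) else 0) + 2 * c := by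
        intro m h1 hm
        have := key m h1 (by omega)
        simp only [intervalRoot, Nat.sub_add_cancel h1] at this
        exact ⟨_, this⟩
      have hodd : ∀ m, 1 ≤ m → m ≤ n →
          ((i ≤ m ∧ m ≤ j) ↔ ((m = s ∧ m ≠ t) ∨ (m ≠ s ∧ m = t))) := by
        intro m h1 hm
        obtain ⟨c, hc⟩ := key2 m h1 hm
        clear key2 key h
        split_ifs at hc <;> omega
      have hcase : (i = s ∧ j = s + 1 ∧ t = s + 1) ∨ (i + 1 = s ∧ j = s ∧ t + 1 = s) := by
        have := adjacent_of_interval n s t i (j) hs1 hsn ht1 htn hi (by omega) (by omega) hodd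
        omega
      rcases hcase with ⟨rfl, rfl, rfl⟩ | ⟨rfl, rfl, h3⟩
      · refine Or.inr (Or.inl ⟨hj, rfl, rfl, ?_⟩)
        ext k
        have := congrFun h k
        simp only [simpleRoot, intervalRoot, Pi.add_apply, two_nsmul] at this ⊢
        split_ifs at this ⊢ <;> omega
      · obtain rfl : i = t := by omega
        refine Or.inl ⟨by omega, by simp, by simp, ?_⟩
        ext k
        have := congrFun h k
        simp only [simpleRoot, intervalRoot, Pi.add_apply, two_nsmul] at this ⊢
        split_ifs at this ⊢ <;> omega
    · have key2 : ∀ m, 1 ≤ m → m ≤ n → ∃ c : ℤ, (if m = s then (1 : ℤ) else 0) +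
          (if m < i then 0 else if m < j then 1 else 2) =
            (if m = t then (1 : ℤ) else 0) + 2 * c := by
        intro m h1 hm
        have := key m h1 (by omega)
        simp only [doubledRootB, Nat.sub_add_cancel h1] at this
        exact ⟨_, this⟩
      have hodd : ∀ m, 1 ≤ m → m ≤ n →
          ((i ≤ m ∧ m ≤ j - 1) ↔ ((m = s ∧ m ≠ t) ∨ (m ≠ s ∧ m = t))) := by
        intro m h1 hm
        obtain ⟨c, hc⟩ := key2 m h1 hm
        clear key2 key h
        split_ifs at hc <;> omega
      have hcase : (i = s ∧ j = s + 2 ∧ t = s + 1) ∨ (i + 1 = s ∧ j = s + 1 ∧ t + 1 = s) := by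
        have := adjacent_of_interval n s t i (j - 1) hs1 hsn ht1 htn hi (by omega) (by omega) hodd
        omega
      rcases hcase with ⟨rfl, rfl, rfl⟩ | ⟨rfl, rfl, h3⟩
      · refine Or.inr (Or.inr (Or.inr ⟨hj, rfl, rfl, ?_⟩))
        ext k
        have hk := k.isLt
        have := congrFun h k
        simp only [simpleRoot, intervalRoot, doubledRootB, Pi.add_apply, two_nsmul] at this ⊢
        split_ifs at this ⊢ <;> omega
      · obtain rfl : i = t := by omega
        refine Or.inr (Or.inr (Or.inl ⟨by omega, hj, by simp, by simp, ?_⟩))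
        ext k
        have hk := k.isLt
        have := congrFun h k
        simp only [simpleRoot, intervalRoot, doubledRootB, Pi.add_apply, two_nsmul] at this ⊢
        split_ifs at this ⊢ <;> omega
  · rintro (⟨h1, rfl, rfl, rfl⟩ | ⟨h1, rfl, rfl, rfl⟩ | ⟨h1, h2, rfl, rfl, rfl⟩ |
      ⟨h1, rfl, rfl, rfl⟩) <;>
    · ext k
      have hk := k.isLt
      simp only [simpleRoot, intervalRoot, doubledRootB, Pi.add_apply, two_nsmul]
      split_ifs <;> omega
end

section
/- Let α = α_s ∈ Δ be a simple root and β ∈ Φ⁺ a positive root of type C_n with α ≠ β. If there exist a simple root β₁ ∈ Δ and σ ∈ ℤ^n with α + β = β₁ + 2σ, then one of the following holds: (i) s ≥ 2, β = α_{s−1} + α_s, β₁ = α_{s−1}, σ = α_s; (ii) s ≤ n−1, β = α_s + α_{s+1}, β₁ = α_{s+1}, σ = α_s; (iii) s = n, β = α_i + 2α_{i+1} + ⋯ + 2α_{n−1} + α_n for some 1 ≤ i ≤ n−2, β₁ = α_i, σ = α_{i+1} + ⋯ + α_{n−1} + α_n; (iv) s ≤ n−2, β = α_s + 2α_{s+1}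 + ⋯ + 2α_{n−1} + α_n, β₁ = α_n, σ = α_s + α_{s+1} + ⋯ + α_{n−1}. Conversely, each listed case is a solution. (This is the classification of solutions of equation α + β = β₁ + 2σ in type C_n used in Section 3.4 of the paper.) -/
set_option maxHeartbeats 4000000

/-- In type `Cₙ`, for the simple root `α = αₛ` and a positive root `β ≠ α`, the solutions
of `α + β = β₁ + 2σ` with `β₁` simple and `σ ∈ ℤⁿ` are exactly the four listed cases:
(i) `β = α_{s-1} + αₛ`, `β₁ = α_{s-1}`, `σ = αₛ` (`s ≥ 2`);
(ii) `β = αₛ + α_{s+1}`, `β₁ = α_{s+1}`, `σ = αₛ` (`s ≤ n-1`);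
(iii) `s = n`, `β = αᵢ + 2α_{i+1} + ⋯ + 2α_{n-1} + αₙ` for some `1 ≤ i ≤ n-2`,
`β₁ = αᵢ`, `σ = α_{i+1} + ⋯ + α_{n-1} + αₙ`;
(iv) `β = αₛ + 2α_{s+1} + ⋯ + 2α_{n-1} + αₙ`, `β₁ = αₙ`,
`σ = αₛ + α_{s+1} + ⋯ + α_{n-1}` (`s ≤ n-2`). -/
theorem Cn_classify_beta1_two_sigma (n : ℕ) (hn : 3 ≤ n) (s : ℕ)
    (hs1 : 1 ≤ s) (hsn : s ≤ n) (β : Fin n → ℤ) (hβ : IsPositiveRootC n β)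
    (hne : simpleRoot n s ≠ β) (β₁ σ : Fin n → ℤ) (hβ₁ : IsSimpleRoot n β₁) :
    simpleRoot n s + β = β₁ + 2 • σ ↔
      (2 ≤ s ∧ β = intervalRoot n (s - 1) s ∧ β₁ = simpleRoot n (s - 1) ∧
        σ = simpleRoot n s) ∨
      (s + 1 ≤ n ∧ β = intervalRoot n s (s + 1) ∧ β₁ = simpleRoot n (s + 1) ∧
        σ = simpleRoot n s) ∨
      (s = n ∧ ∃ i, 1 ≤ i ∧ i + 2 ≤ n ∧ β = doubledRootC n i (i + 1) ∧
        β₁ = simpleRoot n i ∧ σ = intervalRoot n (i + 1) n) ∨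
      (s + 2 ≤ n ∧ β = doubledRootC n s (s + 1) ∧ β₁ = simpleRoot n n ∧
        σ = intervalRoot n s (n - 1)) := by
  obtain ⟨t, ht1, htn, rfl⟩ := hβ₁
  constructor
  · intro h
    have hp : ∀ k : Fin n, simpleRoot n s k + β k = simpleRoot n t k + 2 * σ k := by
      intro k
      have := congrFun h k
      simpa using this
    have H : ∀ m, (hm : 1 ≤ m ∧ m ≤ n) → ∃ k : Fin n, (k : ℕ) + 1 = m := by
      intro m hm
      exact ⟨⟨m - 1, by omega⟩, by simp; omega⟩
    rcases hβ with ⟨i, j, hi, hij, hj, rfl⟩ | ⟨i, j, hi, hij, hj, rfl⟩ | ⟨i, hi, hi', rfl⟩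
    · have P : ∀ m, 1 ≤ m ∧ m ≤ n → ∃ c : ℤ, (if m = s then (1 : ℤ) else 0) +
          (if i ≤ m ∧ m ≤ j then 1 else 0) = (if m = t then 1 else 0) + 2 * c := by
        intro m hm
        obtain ⟨k, rfl⟩ := H m hm
        exact ⟨σ k, hp k⟩
      have hj2 : j ≤ i + 1 := by
        by_contra hc
        obtain ⟨a, ha⟩ := P i (by omega)
        obtain ⟨b, hb⟩ := P (i + 1) (by omega)
        obtain ⟨c, hc'⟩ := P (i + 2) (by omega)
        have hx : s = i ∨ t = i := by
          split_ifs at ha <;> omega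
        have hy : s = i + 1 ∨ t = i + 1 := by
          split_ifs at hb <;> omega
        have hz : s = i + 2 ∨ t = i + 2 := by
          split_ifs at hc' <;> omega
        omega
      have key : j = i + 1 ∧ ((s = i ∧ t = i + 1) ∨ (s = i + 1 ∧ t = i)) := by
        obtain ⟨a, ha⟩ := P i (by omega)
        obtain rfl | rfl : j = i ∨ j = i + 1 := by omega
        · exfalso
          have hx : (s = j ∧ t ≠ j) ∨ (s ≠ j ∧ t = j) := by
            split_ifs at ha <;> omega
          rcases hx with ⟨h1, h2⟩ | ⟨h1, h2⟩
          · obtain ⟨d, hd⟩ := P t (by omega)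
            split_ifs at hd <;> omega
          · obtain ⟨d, hd⟩ := P s (by omega)
            split_ifs at hd <;> omega
        · obtain ⟨b, hb⟩ := P (i + 1) (by omega)
          have hx : (s = i ∧ t ≠ i) ∨ (s ≠ i ∧ t = i) := by
            split_ifs at ha <;> omega
          have hy : (s = i + 1 ∧ t ≠ i + 1) ∨ (s ≠ i + 1 ∧ t = i + 1) := by
            split_ifs at hb <;> omega
          omega
      obtain ⟨rfl, ⟨rfl, rfl⟩ | ⟨rfl, rfl⟩⟩ := key
      · right; left
        refine ⟨by omega, rfl, rfl, ?_⟩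
        funext k
        have := hp k
        simp only [simpleRoot, intervalRoot] at this ⊢
        split_ifs at this ⊢ <;> omega
      · left
        refine ⟨by omega, by simp, by simp, ?_⟩
        funext k
        have := hp k
        simp only [simpleRoot, intervalRoot] at this ⊢
        split_ifs at this ⊢ <;> omega
    · have P : ∀ m, 1 ≤ m ∧ m ≤ n → ∃ c : ℤ, (if m = s then (1 : ℤ) else 0) +
          (if m = n then 1 else if m < i then 0 else if m < j then 1 else 2)
            = (if m = t then 1 else 0) + 2 * c := by
        intro m hm
        obtain ⟨k, rfl⟩ := H m hm
        exact ⟨σ k, hp k⟩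
      have hj2 : j = i + 1 := by
        by_contra hc
        obtain ⟨a, ha⟩ := P i (by omega)
        obtain ⟨b, hb⟩ := P (i + 1) (by omega)
        obtain ⟨c, hc'⟩ := P n (by omega)
        have hx : s = i ∨ t = i := by
          split_ifs at ha <;> omega
        have hy : s = i + 1 ∨ t = i + 1 := by
          split_ifs at hb <;> omega
        have hz : s = n ∨ t = n := by
          split_ifs at hc' <;> omega
        omega
      subst hj2
      have key : (s = i ∧ t = n) ∨ (s = n ∧ t = i) := by
        obtain ⟨a, ha⟩ := P i (by omega)
        obtain ⟨b, hb⟩ := P n (by omega)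
        have hx : (s = i ∧ t ≠ i) ∨ (s ≠ i ∧ t = i) := by
          split_ifs at ha <;> omega
        have hy : (s = n ∧ t ≠ n) ∨ (s ≠ n ∧ t = n) := by
          split_ifs at hb <;> omega
        omega
      obtain ⟨rfl, rfl⟩ | ⟨rfl, rfl⟩ := key
      · right; right; right
        refine ⟨by omega, rfl, rfl, ?_⟩
        funext k
        have := hp k
        have hk := k.2
        simp only [simpleRoot, intervalRoot, doubledRootC] at this ⊢
        split_ifs at this ⊢ <;> omega
      · right; right; left
        refine ⟨rfl, t, by omega, by omega, rfl, rfl, ?_⟩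
        funext k
        have := hp k
        have hk := k.2
        simp only [simpleRoot, intervalRoot, doubledRootC] at this ⊢
        split_ifs at this ⊢ <;> omega
    · exfalso
      have P : ∀ m, 1 ≤ m ∧ m ≤ n → ∃ c : ℤ, (if m = s then (1 : ℤ) else 0) +
          (if m = n then 1 else if m < i then 0 else if m < i then 1 else 2)
            = (if m = t then 1 else 0) + 2 * c := by
        intro m hm
        obtain ⟨k, rfl⟩ := H m hm
        exact ⟨σ k, hp k⟩
      obtain ⟨b, hb⟩ := P n (by omega)
      have hx : (s = n ∧ t ≠ n) ∨ (s ≠ n ∧ t = n) := by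
        split_ifs at hb <;> omega
      rcases hx with ⟨h1, h2⟩ | ⟨h1, h2⟩
      · obtain ⟨d, hd⟩ := P t (by omega)
        split_ifs at hd <;> omega
      · obtain ⟨d, hd⟩ := P s (by omega)
        split_ifs at hd <;> omega
  · rintro (⟨h1, hb, ht, rfl⟩ | ⟨h1, hb, ht, rfl⟩ | ⟨rfl, i, h1, h2, hb, ht, rfl⟩ |
      ⟨h1, hb, ht, rfl⟩) <;> rw [hb, ht] <;> funext k <;> have hk := k.2 <;>
      simp only [simpleRoot, intervalRoot, doubledRootC, Pi.add_apply, Pi.mul_apply, Pi.ofNat_apply,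
        nsmul_eq_mul, Nat.cast_ofNat] <;>
      split_ifs <;> first | omega | simp
end

section
/- Let α ∈ Δ be a simple root and β ∈ Φ⁺ a positive root of type D_n with α ≠ β. If there exist a simple root β₁ ∈ Δ and σ ∈ ℤ^n with α + β = β₁ + 2σ, then β = α + γ for some simple root γ adjacent to α in the Dynkin diagram of D_n, and then β₁ = γ and σ = α. Conversely, for every simple root γ adjacent to α, the triple (β, β₁, σ) = (α + γ, γ, α) is a solution (and α + γ is indeed a positive root). (This is the classification of solutions of equation α + β = β₁ + 2σ in type D_n used in Section 3.5 of the paper.) -/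
/-- The simple roots `αₛ` and `α_t` are adjacent in the Dynkin diagram of `Dₙ`:
`{s, t} = {i, i+1}` for some `1 ≤ i ≤ n-2`, or `{s, t} = {n-2, n}`. -/
def AdjacentD (n s t : ℕ) : Prop :=
  (∃ i, 1 ≤ i ∧ i + 2 ≤ n ∧ ({s, t} : Set ℕ) = {i, i + 1}) ∨
  ({s, t} : Set ℕ) = {n - 2, n}

theorem adjacentD_iff (n s t : ℕ) (hn : 4 ≤ n) : AdjacentD n s t ↔
    (1 ≤ s ∧ s + 2 ≤ n ∧ t = s + 1) ∨ (1 ≤ t ∧ t + 2 ≤ n ∧ s = t + 1) ∨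
    (s + 2 = n ∧ t = n) ∨ (t + 2 = n ∧ s = n) := by
  unfold AdjacentD
  simp only [Set.pair_eq_pair_iff]
  constructor
  · rintro (⟨i, h1, h2, h3⟩ | h) <;> omega
  · rintro (h | h | h | h)
    · exact Or.inl ⟨s, by omega, by omega, by omega⟩
    · exact Or.inl ⟨t, by omega, by omega, by omega⟩
    · right; omega
    · right; omega

/-- A sum of two adjacent simple roots is a positive root. -/
theorem adjacent_sum_pos (n s t : ℕ) (hn : 4 ≤ n) (h : AdjacentD n s t) :
    IsPositiveRootD n (simpleRoot n s + simpleRoot n t) := by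
  rw [adjacentD_iff n s t hn] at h
  rcases h with h | h | h | h
  · refine Or.inl ⟨s, t, by omega, by omega, by omega, ?_⟩
    funext k
    simp only [Pi.add_apply, simpleRoot, intervalRoot]
    split_ifs <;> omega
  · refine Or.inl ⟨t, s, by omega, by omega, by omega, ?_⟩
    funext k
    simp only [Pi.add_apply, simpleRoot, intervalRoot]
    split_ifs <;> omega
  · refine Or.inr (Or.inr (Or.inl ⟨s, by omega, by omega, ?_⟩))
    funext k
    simp only [Pi.add_apply, simpleRoot, rootDn]
    split_ifs <;> omega
  · refine Or.inr (Or.inr (Or.inl ⟨t, by omega, by omega, ?_⟩))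
    funext k
    simp only [Pi.add_apply, simpleRoot, rootDn]
    split_ifs <;> omega

/-- A positive root with the parity of `αₛ + αₜ` which is not `αₛ` equals it, and `s,t`
are adjacent. -/
theorem root_of_parity (n s t : ℕ) (hn : 4 ≤ n) (hs1 : 1 ≤ s) (hsn : s ≤ n)
    (ht1 : 1 ≤ t) (htn : t ≤ n) (β : Fin n → ℤ) (hβ : IsPositiveRootD n β)
    (h : ∀ k (hk : k < n), β ⟨k, hk⟩ % 2 = 1 ↔ ¬ (k + 1 = s ↔ k + 1 = t)) :
    AdjacentD n s t ∧ β = simpleRoot n s + simpleRoot n t := by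
  rw [adjacentD_iff n s t hn]
  rcases hβ with ⟨i, j, hi, hij, hj, rfl⟩ | rfl | ⟨i, hi, hin, rfl⟩ | ⟨i, j, hi, hij, hj, rfl⟩
  · have H : ∀ k, k < n → ((i ≤ k + 1 ∧ k + 1 ≤ j) ↔ ¬ (k + 1 = s ↔ k + 1 = t)) := by
      intro k hk
      rw [← h k hk]
      simp only [intervalRoot]
      split_ifs with h1 <;> omega
    have a1 := H (i - 1) (by omega)
    have a2 := H (j - 1) (by omega)
    have a3 := H (s - 1) (by omega)
    have a4 := H (t - 1) (by omega)
    have a5 := H i (by omega)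
    have a : (s = i ∧ t = i + 1 ∧ j = i + 1) ∨ (t = i ∧ s = i + 1 ∧ j = i + 1) := by omega
    refine ⟨by omega, ?_⟩
    clear a1 a2 a3 a4 a5 H h
    funext k
    simp only [Pi.add_apply, simpleRoot, intervalRoot]
    split_ifs <;> omega
  · exfalso
    have H : ∀ k, k < n → ((k + 1 = n) ↔ ¬ (k + 1 = s ↔ k + 1 = t)) := by
      intro k hk
      rw [← h k hk]
      simp only [simpleRoot]
      split_ifs with h1 <;> omega
    have a1 := H (n - 1) (by omega)
    have a3 := H (s - 1) (by omega)
    have a4 := H (t - 1) (by omega)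
    omega
  · have H : ∀ k, k < n → ((k + 1 = n ∨ (i ≤ k + 1 ∧ k + 1 ≤ n - 2)) ↔
        ¬ (k + 1 = s ↔ k + 1 = t)) := by
      intro k hk
      rw [← h k hk]
      simp only [rootDn]
      split_ifs with h1 h2 <;> omega
    have a1 := H (i - 1) (by omega)
    have a2 := H (n - 1) (by omega)
    have a3 := H (s - 1) (by omega)
    have a4 := H (t - 1) (by omega)
    have a5 := H i (by omega)
    have a : (s = i ∧ t = n ∧ i + 2 = n) ∨ (t = i ∧ s = n ∧ i + 2 = n) := by omega
    refine ⟨by omega, ?_⟩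
    clear a1 a2 a3 a4 a5 H h
    funext k
    simp only [Pi.add_apply, simpleRoot, rootDn]
    split_ifs <;> omega
  · exfalso
    have H : ∀ k, k < n → ((n - 1 ≤ k + 1 ∨ (i ≤ k + 1 ∧ k + 1 < j)) ↔
        ¬ (k + 1 = s ↔ k + 1 = t)) := by
      intro k hk
      rw [← h k hk]
      simp only [doubledRootD]
      split_ifs with h1 h2 h3 <;> omega
    have a1 := H (i - 1) (by omega)
    have a2 := H (n - 1) (by omega)
    have a3 := H (n - 2) (by omega)
    omega

/-- In type `Dₙ`, for the simple root `α = αₛ` and a positive root `β ≠ α`: the equation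
`α + β = β₁ + 2σ` (with `β₁` simple, `σ ∈ ℤⁿ`) holds iff `β = α + γ` for a simple root
`γ = α_t` adjacent to `α`, with `β₁ = γ` and `σ = α`; and moreover `α + γ` is a positive
root for every simple root `γ` adjacent to `α`. -/
theorem Dn_classify_beta1_two_sigma (n : ℕ) (hn : 4 ≤ n) (s : ℕ)
    (hs1 : 1 ≤ s) (hsn : s ≤ n) (β : Fin n → ℤ) (hβ : IsPositiveRootD n β)
    (hne : simpleRoot n s ≠ β) :
    (∀ β₁ σ : Fin n → ℤ, IsSimpleRoot n β₁ →
      (simpleRoot n s + β = β₁ + 2 • σ ↔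
        ∃ t, 1 ≤ t ∧ t ≤ n ∧ AdjacentD n s t ∧
          β = simpleRoot n s + simpleRoot n t ∧ β₁ = simpleRoot n t ∧
          σ = simpleRoot n s)) ∧
    (∀ t, 1 ≤ t → t ≤ n → AdjacentD n s t →
      IsPositiveRootD n (simpleRoot n s + simpleRoot n t)) := by
  refine ⟨?_, fun t _ _ h => adjacent_sum_pos n s t hn h⟩
  rintro β₁ σ ⟨t, ht1, htn, rfl⟩
  constructor
  · intro h
    have hp : ∀ k (hk : k < n), β ⟨k, hk⟩ % 2 = 1 ↔ ¬ (k + 1 = s ↔ k + 1 = t) := by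
      intro k hk
      have h1 := congrFun h ⟨k, hk⟩
      simp only [Pi.add_apply, two_nsmul, simpleRoot] at h1
      split_ifs at h1 <;> omega
    obtain ⟨hadj, hb⟩ := root_of_parity n s t hn hs1 hsn ht1 htn β hβ hp
    refine ⟨t, ht1, htn, hadj, hb, rfl, ?_⟩
    funext k
    have h1 := congrFun h k
    have h2 := congrFun hb k
    simp only [Pi.add_apply, two_nsmul] at h1 h2
    omega
  · rintro ⟨u, _, _, _, hb, h1, rfl⟩
    rw [hb, h1, two_nsmul]
    abel
end
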